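/- arXiv:0706.0973 — 2 statements merged into one kernel-verified Lean document; each statement's English description precedes it below -/
import Mathlib

section
/- Let H = {w ∈ ℂ : Re w < 0} be the left half-plane and let g : H → ℂ be holomorphic with g'(w) ≠ 0 and |g(w)| ≠ 1 for every w ∈ H. Suppose there exists T ∈ SU(1,1) such that (T₂₁·g(w) + T₂₂)·g(w+2πi) = T₁₁·g(w) + T₁₂ for all w ∈ H. Then the function w ↦ S(g)(w) + 1/2 (Schwarzian derivative with respect to w) is 2πi-periodic, hence of the form ψ(e^w) for a holomorphic function ψ on the punctured unit disk Δ* = {0 < |z| < 1}, and ψ extends holomorphically across z = 0. (This expresses the paper's Theorem: any conformal hyperbolic metric on the punctured disk has a regular singularity at the puncture, i.e. its Schwarzian derivative has at most a pole of order 2 there; g is a developing map of the metric 4|dg|²/(1−|g|²)².) -/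
open Complex Matrix Metric

noncomputable section

/-- The matrix `e₃ = diag(1,-1)`. -/
def e3 : Matrix (Fin 2) (Fin 2) ℂ := !![1, 0; 0, -1]

/-- `SU(1,1)`: matrices of determinant 1 with `S e₃ S* = e₃`. -/
def SU11 (S : Matrix (Fin 2) (Fin 2) ℂ) : Prop :=
  S.det = 1 ∧ S * e3 * Sᴴ = e3

/-- The Schwarzian derivative `S(f) = (f''/f')' - (1/2)(f''/f')²`. -/
def schwarzian (f : ℂ → ℂ) (z : ℂ) : ℂ :=
  deriv (fun w => deriv (deriv f) w / deriv f w) z -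
    (1 / 2) * (deriv (deriv f) z / deriv f z) ^ 2

theorem schwarzian_inv_sub_const {f : ℂ → ℂ} {z ζ : ℂ} (hf : AnalyticAt ℂ f z)
    (hf' : deriv f z ≠ 0) (hζ : f z ≠ ζ) :
    schwarzian (fun w => (f w - ζ)⁻¹) z = schwarzian f z := by
  have hne : ∀ᶠ w in nhds z, f w - ζ ≠ 0 :=
    (hf.continuousAt.sub continuousAt_const).eventually_ne (sub_ne_zero.2 hζ)
  have hne' : ∀ᶠ w in nhds z, deriv f w ≠ 0 := hf.deriv.continuousAt.eventually_ne hf'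
  have h1 : ∀ᶠ w in nhds z, deriv (fun w => (f w - ζ)⁻¹) w = -deriv f w / (f w - ζ) ^ 2 := by
    filter_upwards [hne, hf.eventually_analyticAt] with w hw hfw
    exact ((hfw.differentiableAt.hasDerivAt.sub_const ζ).inv hw).deriv
  have h2 : ∀ᶠ w in nhds z, deriv (deriv (fun w => (f w - ζ)⁻¹)) w =
      -deriv (deriv f) w / (f w - ζ) ^ 2 + 2 * deriv f w ^ 2 / (f w - ζ) ^ 3 := by
    filter_upwards [hne, hf.eventually_analyticAt, h1.eventually_nhds] with w hw hfw h
    have e : deriv (fun w => (f w - ζ)⁻¹) =ᶠ[nhds w] fun w => -deriv f w / (f w - ζ) ^ 2 := h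
    rw [e.deriv_eq]
    have := (hfw.deriv.differentiableAt.hasDerivAt.neg).div
      ((hfw.differentiableAt.hasDerivAt.sub_const ζ).pow 2) (pow_ne_zero 2 hw)
    refine (this.deriv).trans ?_
    simp only [Pi.neg_apply, Pi.pow_apply]
    field_simp
    push_cast
    ring
  have h3 : ∀ᶠ w in nhds z, deriv (deriv (fun w => (f w - ζ)⁻¹)) w /
      deriv (fun w => (f w - ζ)⁻¹) w =
      deriv (deriv f) w / deriv f w - 2 * (deriv f w / (f w - ζ)) := by
    filter_upwards [hne, hne', h1, h2] with w hw hw' h1 h2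
    rw [h1, h2]
    field_simp
    ring
  have h4 : deriv (fun w => deriv (deriv (fun w => (f w - ζ)⁻¹)) w /
      deriv (fun w => (f w - ζ)⁻¹) w) z = deriv (fun w => deriv (deriv f) w / deriv f w) z -
        2 * ((deriv (deriv f) z * (f z - ζ) - deriv f z * deriv f z) / (f z - ζ) ^ 2) := by
    rw [Filter.EventuallyEq.deriv_eq h3]
    have a1 : DifferentiableAt ℂ (fun w => deriv (deriv f) w / deriv f w) z :=
      hf.deriv.deriv.differentiableAt.div hf.deriv.differentiableAt hf'
    have a2 := (hf.deriv.differentiableAt.hasDerivAt.div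
      (hf.differentiableAt.hasDerivAt.sub_const ζ) hne.self_of_nhds).const_mul (2 : ℂ)
    exact (a1.hasDerivAt.sub a2).deriv
  unfold schwarzian
  rw [h4, h3.self_of_nhds]
  have := hne.self_of_nhds
  field_simp
  ring

/-- A function on the left half-plane which is invariant under `w ↦ w + 2πi` descends to the
punctured unit disk along the exponential. -/
theorem comp_log_exp_of_periodic {F : ℂ → ℂ} (hF : ∀ w : ℂ, w.re < 0 → DifferentiableAt ℂ F w)
    (hper : ∀ w : ℂ, w.re < 0 → F (w + 2 * Real.pi * Complex.I) = F w) {w : ℂ} (hw : w.re < 0) :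
    F (log (exp w)) = F w ∧ DifferentiableAt ℂ (fun z => F (log z)) (exp w) := by
  have hnat : ∀ (n : ℕ) (v : ℂ), v.re < 0 → F (v + n * (2 * Real.pi * Complex.I)) = F v := by
    intro n
    induction n with
    | zero => intro v _; simp
    | succ k ih =>
      intro v hv
      rw [← ih v hv, ← hper (v + k * (2 * Real.pi * Complex.I)) (by simpa using hv)]
      congr 1
      push_cast
      ring
  have key : ∀ u v : ℂ, v.re < 0 → exp u = exp v → F u = F v := by
    intro u v hv h
    obtain ⟨n, rfl⟩ := exp_eq_exp_iff_exists_int.1 h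
    obtain ⟨m, rfl | rfl⟩ := n.eq_nat_or_neg
    · simpa using hnat m v hv
    · rw [← hnat m (v + _) (by simpa using hv)]
      congr 1
      push_cast
      ring
  refine ⟨key _ _ hw (exp_log (exp_ne_zero w)), ?_⟩
  have hd : DifferentiableAt ℂ (fun z : ℂ => F (log (z / exp w) + w)) (exp w) := by
    have h1 : DifferentiableAt ℂ (fun z : ℂ => log (z / exp w) + w) (exp w) := by
      refine (DifferentiableAt.clog (by fun_prop) ?_).add_const w
      simp
    refine DifferentiableAt.comp (g := F) (exp w) ?_ h1
    simpa [div_self (exp_ne_zero w)] using hF w hw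
  refine hd.congr_of_eventuallyEq ?_
  have hn : ∀ᶠ z in nhds (exp w), z ≠ 0 := eventually_ne_nhds (exp_ne_zero w)
  have hn1 : ∀ᶠ z in nhds (exp w), ‖z‖ < 1 :=
    continuous_norm.continuousAt.eventually_lt continuousAt_const
      (by rw [norm_exp]; simpa using hw)
  filter_upwards [hn, hn1] with z hz hz1
  refine (key _ _ ?_ ?_).symm
  · rw [log_re]
    exact Real.log_neg (norm_pos_iff.2 hz) hz1
  · rw [exp_log hz, exp_add, exp_log (div_ne_zero hz (exp_ne_zero w)),
      div_mul_cancel₀ _ (exp_ne_zero w)]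

/-- If `f` is holomorphic without zeros on the punctured disk and of moderate growth at `0`, then
`z f'(z) / f(z)` extends holomorphically across `0`. -/
theorem exists_extension_mul_logDeriv {f : ℂ → ℂ}
    (hf : ∀ z : ℂ, z ≠ 0 → ‖z‖ < 1 → DifferentiableAt ℂ f z)
    (hf0 : ∀ z : ℂ, z ≠ 0 → ‖z‖ < 1 → f z ≠ 0) {C r : ℝ} {N : ℕ} (hr : 0 < r)
    (hbd : ∀ z : ℂ, z ≠ 0 → ‖z‖ < r → ‖z ^ N * f z‖ ≤ C) :
    ∃ l : ℂ → ℂ, DifferentiableOn ℂ l (ball 0 1) ∧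
      ∀ z : ℂ, z ≠ 0 → l z = z * logDeriv f z := by
  have hpunc : ∀ᶠ z in nhdsWithin (0 : ℂ) {0}ᶜ, z ≠ 0 ∧ ‖z‖ < 1 :=
    Filter.Eventually.and self_mem_nhdsWithin
      (nhdsWithin_le_nhds (Filter.mem_of_superset (ball_mem_nhds (0 : ℂ) one_pos) fun z hz => by
        simpa using hz))
  have hmer : MeromorphicAt f 0 := by
    have h1 : MeromorphicAt (fun z : ℂ => z ^ N * f z) 0 := by
      have hs : ball (0 : ℂ) (min r 1) ∈ nhds 0 := ball_mem_nhds _ (lt_min hr one_pos)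
      have := Complex.differentiableOn_update_limUnder_of_bddAbove
        (f := fun z : ℂ => z ^ N * f z) hs
        (by
          rintro z ⟨hz, hz0⟩
          simp at hz hz0
          exact (((differentiableAt_id.pow N).mul (hf z hz0 hz.2))).differentiableWithinAt)
        ⟨C, by
          rintro _ ⟨z, ⟨hz, hz0⟩, rfl⟩
          simp only [mem_ball_zero_iff, lt_min_iff, Set.mem_singleton_iff] at hz hz0
          exact hbd z hz0 hz.1⟩
      refine (this.analyticAt hs).meromorphicAt.congr ?_
      filter_upwards [self_mem_nhdsWithin] with z hz
      exact Function.update_of_ne hz _ _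
    have h2 : MeromorphicAt (fun z : ℂ => (z ^ N)⁻¹ * (z ^ N * f z)) 0 :=
      ((MeromorphicAt.id 0).pow N).inv.mul h1
    refine h2.congr ?_
    filter_upwards [self_mem_nhdsWithin] with z hz
    exact inv_mul_cancel_left₀ (pow_ne_zero N hz) _
  have hord := (meromorphicOrderAt_ne_top_iff_eventually_ne_zero hmer).2
    (hpunc.mono fun z hz => hf0 z hz.1 hz.2)
  obtain ⟨h, hh, hh0, heq⟩ := (meromorphicOrderAt_ne_top_iff hmer).1 hord
  set m := (meromorphicOrderAt f 0).untop₀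
  have han : AnalyticAt ℂ (fun z => (m : ℂ) + z * (deriv h z / h z)) 0 :=
    analyticAt_const.add (analyticAt_id.mul (hh.deriv.div hh hh0))
  refine ⟨fun z => if z = 0 then (m : ℂ) else z * logDeriv f z, ?_, fun z hz => if_neg hz⟩
  intro z hz
  simp only [mem_ball_zero_iff] at hz
  refine DifferentiableAt.differentiableWithinAt ?_
  rcases eq_or_ne z 0 with rfl | hz0
  · refine han.differentiableAt.congr_of_eventuallyEq ?_
    have e1 := eventually_nhdsWithin_iff.1 (eventually_eventually_nhdsWithin.2 heq)
    have e2 := hh.continuousAt.eventually_ne hh0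
    filter_upwards [e1, e2, hh.eventually_analyticAt] with z e1 e2 e3
    split_ifs with h0
    · simp [h0]
    · have e4 : f =ᶠ[nhds z] fun z => z ^ m * h z := by
        have := e1 h0
        rw [IsOpen.nhdsWithin_eq isOpen_compl_singleton h0] at this
        simpa [Filter.EventuallyEq] using this
      rw [logDeriv_apply, e4.deriv_eq, e4.self_of_nhds, ← logDeriv_apply,
        logDeriv_mul (f := (· ^ m)) z (zpow_ne_zero m h0) e2 (differentiableAt_zpow.2 (Or.inl h0))
          e3.differentiableAt, logDeriv_zpow, logDeriv_apply]
      field_simp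
  · have hfd : ∀ᶠ w in nhds z, DifferentiableAt ℂ f w := by
      filter_upwards [eventually_ne_nhds hz0,
        continuous_norm.continuousAt.eventually_lt continuousAt_const hz] with w h1 h2
      exact hf w h1 h2
    have hfa : AnalyticAt ℂ f z := analyticAt_iff_eventually_differentiableAt.2 hfd
    have : AnalyticAt ℂ (fun z => z * (deriv f z / f z)) z :=
      analyticAt_id.mul (hfa.deriv.div hfa (hf0 z hz0 hz))
    refine this.differentiableAt.congr_of_eventuallyEq ?_
    filter_upwards [eventually_ne_nhds hz0] with w hw
    simp [hw, logDeriv_apply]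

/-- The Schwarz–Pick inequality on a disk centred at `c`. -/
theorem schwarz_pick_ball {f : ℂ → ℂ} {c z : ℂ} {R : ℝ} (hd : DifferentiableOn ℂ f (ball c R))
    (hf : ∀ w ∈ ball c R, ‖f w‖ < 1) (hz : z ∈ ball c R) :
    (1 - (‖z - c‖ / R) ^ 2) * (1 - ‖f z‖) ^ 2 ≤ 1 - ‖f c‖ ^ 2 := by
  have hR : 0 < R := nonempty_ball.1 ⟨z, hz⟩
  have hc : ‖f c‖ < 1 := hf c (mem_ball_self hR)
  set a := f c with ha
  have hnorm : ∀ b : ℂ, ‖1 - star a * b‖ ^ 2 - ‖b - a‖ ^ 2 = (1 - ‖a‖ ^ 2) * (1 - ‖b‖ ^ 2) := by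
    intro b
    simp only [← normSq_eq_norm_sq, normSq_apply, star_def, sub_re, sub_im, mul_re, mul_im,
      conj_re, conj_im, one_re, one_im]
    ring
  have hden : ∀ b : ℂ, ‖b‖ < 1 → 1 - ‖b‖ ≤ ‖1 - star a * b‖ := by
    intro b hb
    have h1 : ‖(1 : ℂ)‖ - ‖star a * b‖ ≤ ‖1 - star a * b‖ := norm_sub_norm_le _ _
    rw [norm_mul, norm_star, norm_one] at h1
    nlinarith [norm_nonneg a, norm_nonneg b]
  have hdne : ∀ b : ℂ, ‖b‖ < 1 → 1 - star a * b ≠ 0 := fun b hb =>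
    norm_pos_iff.1 (lt_of_lt_of_le (by linarith) (hden b hb))
  set k : ℂ → ℂ := fun w => (f w - a) / (1 - star a * f w) with hk
  have hkc : k c = 0 := by simp [hk, ha]
  have h1a : 0 < 1 - ‖a‖ ^ 2 := by nlinarith [norm_nonneg a]
  have hkd : DifferentiableOn ℂ k (ball c R) := fun w hw =>
    ((hd w hw).sub_const a).div (((hd w hw).const_mul _).const_sub 1) (hdne _ (hf w hw))
  have hkm : Set.MapsTo k (ball c R) (closedBall (k c) 1) := by
    intro w hw
    rw [hkc, mem_closedBall_zero_iff, norm_div]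
    refine div_le_one_of_le₀ ?_ (norm_nonneg _)
    have := hnorm (f w)
    have h2 : 0 < 1 - ‖f w‖ ^ 2 := by nlinarith [norm_nonneg (f w), hf w hw]
    refine le_of_sq_le_sq ?_ (norm_nonneg _)
    nlinarith [mul_pos h1a h2]
  have hS := Complex.dist_le_div_mul_dist_of_mapsTo_ball hkd hkm hz
  rw [hkc, dist_zero_right, dist_eq_norm, norm_div, one_div_mul_eq_div] at hS
  have hb := hf z hz
  have hpos : 0 < ‖1 - star a * f z‖ := norm_pos_iff.2 (hdne _ hb)
  rw [div_le_iff₀ hpos] at hS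
  have hS2 := pow_le_pow_left₀ (norm_nonneg _) hS 2
  rw [mul_pow] at hS2
  have hq : 0 ≤ 1 - (‖z - c‖ / R) ^ 2 := by
    have : ‖z - c‖ / R ≤ 1 := div_le_one_of_le₀ (by
      simpa [dist_eq_norm] using (mem_ball.1 hz).le) hR.le
    have h0 : 0 ≤ ‖z - c‖ / R := by positivity
    nlinarith
  calc (1 - (‖z - c‖ / R) ^ 2) * (1 - ‖f z‖) ^ 2
      ≤ (1 - (‖z - c‖ / R) ^ 2) * ‖1 - star a * f z‖ ^ 2 := by
        have h0 : 0 ≤ 1 - ‖f z‖ := by linarith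
        have := hden _ hb
        gcongr
    _ ≤ (1 - ‖a‖ ^ 2) * (1 - ‖f z‖ ^ 2) := by rw [← hnorm]; linarith
    _ ≤ 1 - ‖a‖ ^ 2 := by nlinarith [sq_nonneg ‖f z‖]

/-- If `G` is locally univalent on the left half-plane, has affine monodromy and a derivative of
moderate growth, then `S(G) + 1/2` descends to a holomorphic function on the unit disk. -/
theorem schwarzian_descends_of_affine_monodromy {G : ℂ → ℂ}
    (hG : ∀ w : ℂ, w.re < 0 → DifferentiableAt ℂ G w)
    (hG' : ∀ w : ℂ, w.re < 0 → deriv G w ≠ 0) {α β : ℂ} (hα : α ≠ 0)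
    (hm : ∀ w : ℂ, w.re < 0 → G (w + 2 * Real.pi * Complex.I) = α * G w + β) {C R : ℝ}
    (hR : 0 ≤ R)
    (hbd : ∀ w : ℂ, w.re < -R → |w.im| ≤ Real.pi → ‖deriv G w‖ ≤ C * Real.exp (-(2 * w.re))) :
    ∃ ψ : ℂ → ℂ, DifferentiableOn ℂ ψ (ball (0 : ℂ) 1) ∧
      ∀ w : ℂ, w.re < 0 → schwarzian G w + 1 / 2 = ψ (Complex.exp w) := by
  have hopen : IsOpen {w : ℂ | w.re < 0} := isOpen_lt continuous_re continuous_const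
  have hGa : ∀ w : ℂ, w.re < 0 → AnalyticAt ℂ G w := fun w hw =>
    analyticAt_iff_eventually_differentiableAt.2 ((hopen.eventually_mem hw).mono hG)
  have hDm : ∀ w : ℂ, w.re < 0 → deriv G (w + 2 * Real.pi * Complex.I) = α * deriv G w := by
    intro w hw
    rw [← deriv_comp_add_const]
    have : (fun w => G (w + 2 * Real.pi * Complex.I)) =ᶠ[nhds w] fun w => α * G w + β :=
      (hopen.eventually_mem hw).mono hm
    rw [this.deriv_eq, deriv_add_const, deriv_const_mul _ (hG w hw)]
  have hpi : (2 * Real.pi * Complex.I : ℂ) ≠ 0 := two_pi_I_ne_zero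
  set κ : ℂ := log α / (2 * Real.pi * Complex.I) with hκ
  have hκα : exp (-(κ * (2 * Real.pi * Complex.I))) * α = 1 := by
    rw [hκ, div_mul_cancel₀ _ hpi, exp_neg, exp_log hα, inv_mul_cancel₀ hα]
  set q : ℂ → ℂ := fun w => deriv G w * exp (-(κ * w)) with hq
  have hqd : ∀ w : ℂ, w.re < 0 → DifferentiableAt ℂ q w := fun w hw =>
    (hGa w hw).deriv.differentiableAt.mul (by fun_prop)
  have hqm : ∀ w : ℂ, w.re < 0 → q (w + 2 * Real.pi * Complex.I) = q w := by
    intro w hw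
    simp only [hq]
    rw [hDm w hw, mul_add, neg_add, exp_add]
    linear_combination (deriv G w * exp (-(κ * w))) * hκα
  set f : ℂ → ℂ := fun z => q (log z) with hf
  have hlog : ∀ z : ℂ, z ≠ 0 → ‖z‖ < 1 → (log z).re < 0 := fun z hz hz1 => by
    rw [log_re]
    exact Real.log_neg (norm_pos_iff.2 hz) hz1
  have hfd : ∀ z : ℂ, z ≠ 0 → ‖z‖ < 1 → DifferentiableAt ℂ f z := fun z hz hz1 => by
    simpa [exp_log hz] using (comp_log_exp_of_periodic hqd hqm (hlog z hz hz1)).2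
  have hf0 : ∀ z : ℂ, z ≠ 0 → ‖z‖ < 1 → f z ≠ 0 := fun z hz hz1 =>
    mul_ne_zero (hG' _ (hlog z hz hz1)) (exp_ne_zero _)
  have hfb : ∀ z : ℂ, z ≠ 0 → ‖z‖ < Real.exp (-R) →
      ‖z ^ (2 + ⌈‖κ‖⌉₊) * f z‖ ≤ C * Real.exp (‖κ‖ * Real.pi) := by
    intro z hz hzR
    have hre : (log z).re < -R := by
      rw [log_re]
      exact (Real.log_lt_iff_lt_exp (norm_pos_iff.2 hz)).2 hzR
    have him : |(log z).im| ≤ Real.pi := by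
      rw [log_im]
      exact abs_arg_le_pi z
    have hb := hbd _ hre him
    have hz' : ‖z‖ = Real.exp (log z).re := by
      rw [log_re, Real.exp_log (norm_pos_iff.2 hz)]
    set w := log z with hw
    have hC : 0 ≤ C := by
      by_contra! h
      have := Real.exp_pos (-(2 * w.re))
      nlinarith [norm_nonneg (deriv G w)]
    have hκw : (-(κ * w)).re ≤ ‖κ‖ * (-w.re + Real.pi) := by
      calc (-(κ * w)).re ≤ ‖-(κ * w)‖ := re_le_norm _
        _ = ‖κ‖ * ‖w‖ := by rw [norm_neg, norm_mul]
        _ ≤ ‖κ‖ * (|w.re| + |w.im|) := by gcongr; exact norm_le_abs_re_add_abs_im w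
        _ ≤ _ := by
          rw [abs_of_neg (by linarith)]
          gcongr
    calc ‖z ^ (2 + ⌈‖κ‖⌉₊) * f z‖
        = Real.exp w.re ^ (2 + ⌈‖κ‖⌉₊) * (‖deriv G w‖ * Real.exp (-(κ * w)).re) := by
          rw [norm_mul, norm_pow, hz', ← norm_exp (-(κ * w)), ← norm_mul]
      _ ≤ Real.exp w.re ^ (2 + ⌈‖κ‖⌉₊) *
          ((C * Real.exp (-(2 * w.re))) * Real.exp (‖κ‖ * (-w.re + Real.pi))) := by gcongr
      _ = C * Real.exp ((2 + ⌈‖κ‖⌉₊ : ℕ) * w.re + -(2 * w.re) +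
          ‖κ‖ * (-w.re + Real.pi)) := by
          rw [Real.exp_add, Real.exp_add, Real.exp_nat_mul]
          ring
      _ ≤ C * Real.exp (‖κ‖ * Real.pi) := by
          gcongr
          push_cast
          nlinarith [Nat.le_ceil ‖κ‖]
  obtain ⟨l, hl, hlf⟩ := exists_extension_mul_logDeriv hfd hf0 (Real.exp_pos (-R)) hfb
  have hexp : ∀ w : ℂ, w.re < 0 → exp w ∈ ball (0 : ℂ) 1 := fun w hw => by
    simpa [norm_exp] using hw
  have hP : ∀ w : ℂ, w.re < 0 → deriv (deriv G) w / deriv G w = κ + l (exp w) := by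
    intro w hw
    have hE : deriv G =ᶠ[nhds w] fun v => exp (κ * v) * (f ∘ exp) v := by
      filter_upwards [hopen.eventually_mem hw] with v hv
      simp only [Function.comp, hf, (comp_log_exp_of_periodic hqd hqm hv).1]
      rw [hq, mul_left_comm, ← exp_add, add_neg_cancel, exp_zero, mul_one]
    have hw1 : ‖exp w‖ < 1 := mem_ball_zero_iff.1 (hexp w hw)
    have hfw := hfd _ (exp_ne_zero w) hw1
    rw [← logDeriv_apply, logDeriv_apply, hE.deriv_eq, hE.self_of_nhds, ← logDeriv_apply,
      logDeriv_mul (f := fun v => exp (κ * v)) w (exp_ne_zero _)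
        (hf0 (exp w) (exp_ne_zero w) hw1) (by fun_prop)
        (hfw.comp w differentiableAt_exp), hlf _ (exp_ne_zero w),
      logDeriv_comp hfw differentiableAt_exp, Complex.deriv_exp, mul_comm (exp w)]
    congr 1
    have : HasDerivAt (fun v => exp (κ * v)) (exp (κ * w) * (κ * 1)) w :=
      ((hasDerivAt_id w).const_mul κ).cexp
    rw [logDeriv_apply, this.deriv]
    field_simp [exp_ne_zero]
  refine ⟨fun z => z * deriv l z - 1 / 2 * (κ + l z) ^ 2 + 1 / 2, ?_, ?_⟩
  · have hl' := hl.deriv isOpen_ball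
    fun_prop
  · intro w hw
    have hPE : (fun v => deriv (deriv G) v / deriv G v) =ᶠ[nhds w] fun v => κ + l (exp v) :=
      (hopen.eventually_mem hw).mono hP
    have hlw : HasDerivAt l (deriv l (exp w)) (exp w) :=
      (hl.differentiableAt (isOpen_ball.mem_nhds (hexp w hw))).hasDerivAt
    have : HasDerivAt (fun v => κ + l (exp v)) (deriv l (exp w) * exp w) w :=
      (hlw.comp w (Complex.hasDerivAt_exp w)).const_add κ
    rw [schwarzian, hPE.deriv_eq, this.deriv, hP w hw]
    ring

/-- A holomorphic map from the left half-plane to the unit disk approaches the unit circle at most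
quadratically along the fundamental strip. -/
theorem one_sub_norm_lower_bound {g : ℂ → ℂ} (hg : ∀ w : ℂ, w.re < 0 → DifferentiableAt ℂ g w)
    (hlt : ∀ w : ℂ, w.re < 0 → ‖g w‖ < 1) {w : ℂ} (hw : w.re < -6) (him : |w.im| ≤ Real.pi) :
    (1 - ‖g (-1)‖) ^ 2 ≤ 2 * w.re ^ 2 * (1 - ‖g w‖) := by
  have hsub : ∀ v ∈ ball w (-w.re), v.re < 0 := by
    intro v hv
    rw [mem_ball, dist_eq_norm] at hv
    have := (re_le_norm (v - w)).trans_lt hv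
    rw [sub_re] at this
    linarith
  have him2 : w.im ^ 2 ≤ 10 := by
    have h1 := Real.pi_lt_d2
    have h2 : w.im ^ 2 ≤ Real.pi ^ 2 := sq_le_sq' (abs_le.1 him).1 (abs_le.1 him).2
    nlinarith [Real.pi_pos]
  have hn : ‖-1 - w‖ ^ 2 = (1 + w.re) ^ 2 + w.im ^ 2 := by
    rw [← normSq_eq_norm_sq, normSq_apply]
    simp
    ring
  have hmem : (-1 : ℂ) ∈ ball w (-w.re) := by
    rw [mem_ball, dist_eq_norm]
    refine lt_of_pow_lt_pow_left₀ 2 (by linarith) ?_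
    rw [hn]
    nlinarith
  have h := schwarz_pick_ball (fun v hv => (hg v (hsub v hv)).differentiableWithinAt)
    (fun v hv => hlt v (hsub v hv)) hmem
  have hre : 0 < w.re ^ 2 := by nlinarith
  have h1 : 1 / w.re ^ 2 ≤ 1 - (‖-1 - w‖ / -w.re) ^ 2 := by
    rw [div_pow, neg_sq, hn, le_sub_iff_add_le, ← add_div, div_le_one hre]
    nlinarith
  have h2 : 1 / w.re ^ 2 * (1 - ‖g (-1)‖) ^ 2 ≤ 1 - ‖g w‖ ^ 2 :=
    (mul_le_mul_of_nonneg_right h1 (sq_nonneg _)).trans h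
  rw [one_div_mul_eq_div, div_le_iff₀ hre] at h2
  have h3 : 1 - ‖g w‖ ^ 2 ≤ 2 * (1 - ‖g w‖) := by nlinarith [sq_nonneg (1 - ‖g w‖)]
  nlinarith

/-- Cauchy estimate for a holomorphic map from the left half-plane to the unit disk. -/
theorem norm_deriv_le_one_of_maps_to_disk {g : ℂ → ℂ}
    (hg : ∀ w : ℂ, w.re < 0 → DifferentiableAt ℂ g w)
    (hlt : ∀ w : ℂ, w.re < 0 → ‖g w‖ < 1) {w : ℂ} (hw : w.re < -1) : ‖deriv g w‖ ≤ 1 := by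
  have hsub : ∀ v ∈ closedBall w 1, v.re < 0 := by
    intro v hv
    rw [mem_closedBall, dist_eq_norm] at hv
    have := (re_le_norm (v - w)).trans hv
    rw [sub_re] at this
    linarith
  have hd : DiffContOnCl ℂ g (ball w 1) := by
    refine DifferentiableOn.diffContOnCl fun v hv => ?_
    rw [closure_ball w one_ne_zero] at hv
    exact (hg v (hsub v hv)).differentiableWithinAt
  simpa using Complex.norm_deriv_le_of_forall_mem_sphere_norm_le one_pos hd
    fun z hz => (hlt z (hsub z (sphere_subset_closedBall hz))).le

/-- A quadratic over `ℂ` whose constant term is at least as large as its leading coefficient has a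
root outside the open unit disk. -/
theorem exists_root_one_le_norm {a b c : ℂ} (ha : a ≠ 0) (h : ‖a‖ ≤ ‖c‖) :
    ∃ ζ : ℂ, a * ζ ^ 2 + b * ζ + c = 0 ∧ 1 ≤ ‖ζ‖ := by
  obtain ⟨s, hs⟩ := IsAlgClosed.exists_pow_nat_eq (b ^ 2 - 4 * a * c) (n := 2) two_pos
  have h1 : a * ((-b + s) / (2 * a)) ^ 2 + b * ((-b + s) / (2 * a)) + c = 0 := by
    field_simp
    linear_combination hs
  have h2 : a * ((-b - s) / (2 * a)) ^ 2 + b * ((-b - s) / (2 * a)) + c = 0 := by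
    field_simp
    linear_combination hs
  have h3 : a * (((-b + s) / (2 * a)) * ((-b - s) / (2 * a))) = c := by
    field_simp
    linear_combination -hs
  by_contra! hcon
  have l1 := hcon _ h1
  have l2 := hcon _ h2
  have h4 := congrArg norm h3
  rw [norm_mul, norm_mul] at h4
  have := norm_pos_iff.2 ha
  have h5 := mul_lt_one_of_nonneg_of_lt_one_left (norm_nonneg _) l1 l2.le
  nlinarith

/-- Descent of the Schwarzian for maps into the unit disk with Möbius monodromy
`g ↦ (a g + b) / (c g + d)`. -/
theorem schwarzian_descends_of_norm_lt_one {g : ℂ → ℂ} {a b c d : ℂ}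
    (hg : ∀ w : ℂ, w.re < 0 → DifferentiableAt ℂ g w)
    (hg' : ∀ w : ℂ, w.re < 0 → deriv g w ≠ 0) (hlt : ∀ w : ℂ, w.re < 0 → ‖g w‖ < 1)
    (hdet : a * d - b * c = 1) (hbc : ‖c‖ ≤ ‖b‖)
    (hm : ∀ w : ℂ, w.re < 0 → (c * g w + d) * g (w + 2 * Real.pi * Complex.I) = a * g w + b) :
    ∃ ψ : ℂ → ℂ, DifferentiableOn ℂ ψ (ball (0 : ℂ) 1) ∧
      ∀ w : ℂ, w.re < 0 → schwarzian g w + 1 / 2 = ψ (Complex.exp w) := by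
  rcases eq_or_ne c 0 with rfl | hc
  · have had : a * d = 1 := by linear_combination hdet
    have ha : a ≠ 0 := left_ne_zero_of_mul_eq_one had
    have hd : d ≠ 0 := right_ne_zero_of_mul_eq_one had
    refine schwarzian_descends_of_affine_monodromy (α := a / d) (β := b / d) (C := 1) (R := 6)
      hg hg' (div_ne_zero ha hd) (fun w hw => ?_) (by norm_num) fun w hw _ => ?_
    · have := hm w hw
      field_simp
      linear_combination this
    · refine (norm_deriv_le_one_of_maps_to_disk hg hlt (by linarith)).trans ?_
      rw [one_mul]
      exact Real.one_le_exp (by linarith)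
  · obtain ⟨ζ, hζ, hζ1⟩ := exists_root_one_le_norm (a := c) (b := d - a) (c := -b) hc
      (by rwa [norm_neg])
    have hne : ∀ w : ℂ, w.re < 0 → g w - ζ ≠ 0 := fun w hw h0 => by
      have := hlt w hw
      rw [sub_eq_zero.1 h0] at this
      linarith
    have hopen : IsOpen {w : ℂ | w.re < 0} := isOpen_lt continuous_re continuous_const
    have hGd : ∀ w : ℂ, w.re < 0 →
        HasDerivAt (fun w => (g w - ζ)⁻¹) (-deriv g w / (g w - ζ) ^ 2) w := fun w hw =>
      ((hg w hw).hasDerivAt.sub_const ζ).inv (hne w hw)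
    have hprod : (a - c * ζ) * (d + c * ζ) = 1 := by linear_combination hdet - c * hζ
    have hp1 := left_ne_zero_of_mul_eq_one hprod
    have hp2 := right_ne_zero_of_mul_eq_one hprod
    have h1 : 0 < 1 - ‖g (-1)‖ := by linarith [hlt (-1) (by simp)]
    obtain ⟨ψ, hψ, hψg⟩ := schwarzian_descends_of_affine_monodromy
      (G := fun w => (g w - ζ)⁻¹) (α := (d + c * ζ) / (a - c * ζ)) (β := c / (a - c * ζ))
      (C := (4 / (1 - ‖g (-1)‖) ^ 2) ^ 2) (R := 6)
      (fun w hw => (hGd w hw).differentiableAt)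
      (fun w hw => by
        rw [(hGd w hw).deriv]
        exact div_ne_zero (neg_ne_zero.2 (hg' w hw)) (pow_ne_zero 2 (hne w hw)))
      (div_ne_zero hp2 hp1)
      (fun w hw => by
        have n1 := hne w hw
        have n2 := hne (w + 2 * Real.pi * Complex.I) (by simpa using hw)
        have key : (g w - ζ) * (a - c * ζ) = (g (w + 2 * Real.pi * Complex.I) - ζ) *
            (c * (g w - ζ) + (d + c * ζ)) := by linear_combination hζ - hm w hw
        generalize g (w + 2 * Real.pi * Complex.I) - ζ = x at n2 key ⊢
        generalize g w - ζ = y at n1 key ⊢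
        generalize a - c * ζ = u at hp1 key ⊢
        field_simp
        linear_combination key)
      (by norm_num)
      (fun w hw him => by
        rw [(hGd w (by linarith)).deriv, norm_div, norm_neg, norm_pow]
        have hgw : 0 < 1 - ‖g w‖ := by linarith [hlt w (by linarith)]
        have hdist : 1 - ‖g w‖ ≤ ‖g w - ζ‖ := by
          have := norm_sub_norm_le ζ (g w)
          rw [norm_sub_rev] at this
          linarith
        have hinv : 1 / (1 - ‖g w‖) ≤ 4 / (1 - ‖g (-1)‖) ^ 2 * Real.exp (-w.re) := by
          have e1 := one_sub_norm_lower_bound hg hlt hw him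
          have e2 := Real.quadratic_le_exp_of_nonneg (x := -w.re) (by linarith)
          have e3 : w.re ^ 2 ≤ 2 * Real.exp (-w.re) := by nlinarith
          rw [div_mul_eq_mul_div, div_le_div_iff₀ hgw (by positivity)]
          nlinarith
        calc ‖deriv g w‖ / ‖g w - ζ‖ ^ 2 ≤ 1 / (1 - ‖g w‖) ^ 2 := by
              gcongr
              exact norm_deriv_le_one_of_maps_to_disk hg hlt (by linarith)
          _ = (1 / (1 - ‖g w‖)) ^ 2 := by rw [_root_.one_div_pow]
          _ ≤ (4 / (1 - ‖g (-1)‖) ^ 2 * Real.exp (-w.re)) ^ 2 := by gcongr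
          _ = _ := by
              rw [mul_pow, ← Real.exp_nat_mul]
              congr 2
              push_cast
              ring)
    refine ⟨ψ, hψ, fun w hw => ?_⟩
    rw [← hψg w hw, schwarzian_inv_sub_const
      (analyticAt_iff_eventually_differentiableAt.2 ((hopen.eventually_mem hw).mono hg))
      (hg' w hw) (sub_ne_zero.1 (hne w hw))]

/-- The entries of a matrix in `SU(1,1)` off the diagonal have equal modulus. -/
theorem SU11.norm_offDiag_eq {T : Matrix (Fin 2) (Fin 2) ℂ} (hT : SU11 T) :
    ‖T 1 0‖ = ‖T 0 1‖ := by
  have h00 := congrFun (congrFun hT.2 0) 0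
  have h11 := congrFun (congrFun hT.2 1) 1
  have h01 := congrFun (congrFun hT.2 0) 1
  simp only [e3, Matrix.mul_apply, Fin.sum_univ_two, conjTranspose_apply, of_apply, cons_val',
    cons_val_zero, cons_val_one, cons_val_fin_one, mul_one, mul_zero, zero_add, add_zero,
    mul_neg, neg_mul, star_def, mul_conj] at h00 h11 h01
  have e00 : normSq (T 0 0) + -normSq (T 0 1) = 1 := by exact_mod_cast h00
  have e11 : normSq (T 1 0) + -normSq (T 1 1) = -1 := by exact_mod_cast h11
  have e01 : normSq (T 0 0) * normSq (T 1 0) = normSq (T 0 1) * normSq (T 1 1) := by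
    have := congrArg normSq (eq_neg_of_add_eq_zero_left h01)
    simpa [normSq_mul] using this
  have : normSq (T 1 0) = normSq (T 0 1) := by
    linear_combination e01 - normSq (T 1 0) * e00 - normSq (T 0 1) * e11
  rw [normSq_eq_norm_sq, normSq_eq_norm_sq] at this
  exact (pow_left_inj₀ (norm_nonneg _) (norm_nonneg _) two_ne_zero).1 this

/-- A map of the left half-plane avoiding the unit circle stays on one side of it. -/
theorem norm_lt_one_or_one_lt_norm {g : ℂ → ℂ}
    (hg : ∀ w : ℂ, w.re < 0 → DifferentiableAt ℂ g w)
    (hg1 : ∀ w : ℂ, w.re < 0 → ‖g w‖ ≠ 1) :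
    (∀ w : ℂ, w.re < 0 → ‖g w‖ < 1) ∨ ∀ w : ℂ, w.re < 0 → 1 < ‖g w‖ := by
  have hpre : IsPreconnected {w : ℂ | w.re < 0} := (convex_halfSpace_re_lt 0).isPreconnected
  have hcont : ContinuousOn (fun w => ‖g w‖) {w : ℂ | w.re < 0} := fun w hw =>
    (hg w hw).continuousAt.norm.continuousWithinAt
  by_contra! h
  obtain ⟨⟨u, hu, hu1⟩, v, hv, hv1⟩ := h
  obtain ⟨w, hw, hw1⟩ := hpre.intermediate_value hv hu hcont ⟨hv1, hu1⟩
  exact hg1 w hw hw1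

/-- Any conformal hyperbolic metric on the punctured disk has a regular
singularity at the puncture: for a developing map `g` on the left half-plane
with `SU(1,1)` monodromy under `w ↦ w + 2πi`, the function
`S(g) + 1/2` is `2πi`-periodic and descends to a holomorphic function of
`z = e^w` on the punctured disk which extends holomorphically across `0`. -/
theorem regular_singularity_of_hyperbolic_metric
    (g : ℂ → ℂ) (T : Matrix (Fin 2) (Fin 2) ℂ)
    (hg : ∀ w : ℂ, w.re < 0 → DifferentiableAt ℂ g w)
    (hg' : ∀ w : ℂ, w.re < 0 → deriv g w ≠ 0)
    (hg1 : ∀ w : ℂ, w.re < 0 → ‖g w‖ ≠ 1)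
    (hT : SU11 T)
    (hmono : ∀ w : ℂ, w.re < 0 →
      (T 1 0 * g w + T 1 1) * g (w + 2 * Real.pi * Complex.I)
        = T 0 0 * g w + T 0 1) :
    (∀ w : ℂ, w.re < 0 →
        schwarzian g (w + 2 * Real.pi * Complex.I) + 1 / 2
          = schwarzian g w + 1 / 2) ∧
    ∃ ψ : ℂ → ℂ, DifferentiableOn ℂ ψ (ball (0 : ℂ) 1) ∧
      ∀ w : ℂ, w.re < 0 → schwarzian g w + 1 / 2 = ψ (Complex.exp w) := by
  have hdet : T 0 0 * T 1 1 - T 0 1 * T 1 0 = 1 := by rw [← det_fin_two]; exact hT.1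
  have main : ∃ ψ : ℂ → ℂ, DifferentiableOn ℂ ψ (ball (0 : ℂ) 1) ∧
      ∀ w : ℂ, w.re < 0 → schwarzian g w + 1 / 2 = ψ (Complex.exp w) := by
    rcases norm_lt_one_or_one_lt_norm hg hg1 with hlt | hgt
    · exact schwarzian_descends_of_norm_lt_one hg hg' hlt hdet hT.norm_offDiag_eq.le hmono
    · have hne : ∀ w : ℂ, w.re < 0 → g w ≠ 0 := fun w hw =>
        norm_pos_iff.1 (one_pos.trans (hgt w hw))
      have hopen : IsOpen {w : ℂ | w.re < 0} := isOpen_lt continuous_re continuous_const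
      have hd : ∀ w : ℂ, w.re < 0 →
          HasDerivAt (fun w => (g w - 0)⁻¹) (-deriv g w / (g w - 0) ^ 2) w := fun w hw =>
        ((hg w hw).hasDerivAt.sub_const 0).inv (by simpa using hne w hw)
      obtain ⟨ψ, hψ, hψg⟩ := schwarzian_descends_of_norm_lt_one (g := fun w => (g w - 0)⁻¹)
        (a := T 1 1) (b := T 1 0) (c := T 0 1) (d := T 0 0)
        (fun w hw => (hd w hw).differentiableAt)
        (fun w hw => by
          rw [(hd w hw).deriv]
          exact div_ne_zero (neg_ne_zero.2 (hg' w hw)) (by simpa using hne w hw))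
        (fun w hw => by
          rw [sub_zero, norm_inv]
          exact inv_lt_one_of_one_lt₀ (hgt w hw))
        (by linear_combination hdet) hT.norm_offDiag_eq.ge
        (fun w hw => by
          have n1 := hne w hw
          have n2 := hne (w + 2 * Real.pi * Complex.I) (by simpa using hw)
          have := hmono w hw
          simp only [sub_zero]
          field_simp
          linear_combination -this)
      refine ⟨ψ, hψ, fun w hw => ?_⟩
      rw [← hψg w hw, schwarzian_inv_sub_const
        (analyticAt_iff_eventually_differentiableAt.2 ((hopen.eventually_mem hw).mono hg))
        (hg' w hw) (hne w hw)]
  refine ⟨fun w hw => ?_, main⟩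
  obtain ⟨ψ, -, hψ⟩ := main
  rw [hψ w hw, hψ _ (by simpa using hw), exp_periodic]
end
end

section
/- Let H = {w ∈ ℂ : Re w < 0} and let g : H → ℂ be holomorphic with |g(w)| < 1 for all w ∈ H. Suppose g(w+2πi) = T⋆g(w) for all w ∈ H, where T ∈ SU(1,1) is parabolic, i.e. there exist P ∈ SU(1,1), t ∈ ℝ∖{0} and ε ∈ {1,−1} with P⁻¹TP = ε·Λ_p(t). Then there exist A ∈ SU(1,1) and a function h holomorphic on the full open unit disk Δ = {|z| < 1} (in particular holomorphic at 0) such that ((R·A)⋆g)(w) = h(e^w) − i·w for all w ∈ H. (This is the normal form of a developing map with parabolic monodromy of the first kind: the Schwarzian derivative minus dz²/(2z²) has at most a simple pole at the puncture.) -/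
open Complex Matrix Metric

noncomputable section

/-- `Λ_p(t) = [[1+it,−it],[it,1−it]]`. -/
def Λp (t : ℝ) : Matrix (Fin 2) (Fin 2) ℂ :=
  !![1 + Complex.I * t, -(Complex.I * t); Complex.I * t, 1 - Complex.I * t]

/-- The matrix `R = (1/2)[[1,1],[i,−i]]`. -/
def Rmat : Matrix (Fin 2) (Fin 2) ℂ :=
  !![1 / 2, 1 / 2; Complex.I / 2, -(Complex.I / 2)]

/-- The Möbius transformation `A ⋆ z = (A₁₁ z + A₁₂)/(A₂₁ z + A₂₂)`. -/
def mobius (A : Matrix (Fin 2) (Fin 2) ℂ) (z : ℂ) : ℂ :=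
  (A 0 0 * z + A 0 1) / (A 1 0 * z + A 1 1)

open Filter Topology Asymptotics

lemma mobius_mul (A B : Matrix (Fin 2) (Fin 2) ℂ) {z : ℂ} (hz : B 1 0 * z + B 1 1 ≠ 0) :
    mobius (A * B) z = mobius A (mobius B z) := by
  simp only [mobius, Matrix.mul_apply, Fin.sum_univ_two]
  have key (a b : ℂ) : a * ((B 0 0 * z + B 0 1) / (B 1 0 * z + B 1 1)) + b =
      ((a * B 0 0 + b * B 1 0) * z + (a * B 0 1 + b * B 1 1)) / (B 1 0 * z + B 1 1) := by
    rw [eq_div_iff hz, add_mul, mul_assoc, div_mul_cancel₀ _ hz]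
    ring
  rw [key, key, div_div_div_cancel_right₀ hz]

lemma mobius_smul {ε : ℂ} (hε : ε ≠ 0) (A : Matrix (Fin 2) (Fin 2) ℂ) (z : ℂ) :
    mobius (ε • A) z = mobius A z := by
  simp only [mobius, Matrix.smul_apply, smul_eq_mul, mul_assoc, ← mul_add]
  exact mul_div_mul_left _ _ hε

lemma SU11.mul {A B : Matrix (Fin 2) (Fin 2) ℂ} (hA : SU11 A) (hB : SU11 B) : SU11 (A * B) := by
  refine ⟨by rw [Matrix.det_mul, hA.1, hB.1, one_mul], ?_⟩
  calc A * B * e3 * (A * B)ᴴ = A * (B * e3 * Bᴴ) * Aᴴ := by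
        simp only [Matrix.conjTranspose_mul, Matrix.mul_assoc]
    _ = e3 := by rw [hB.2, hA.2]

lemma SU11.inv {A : Matrix (Fin 2) (Fin 2) ℂ} (hA : SU11 A) : SU11 A⁻¹ := by
  have hu : IsUnit A.det := by rw [hA.1]; exact isUnit_one
  refine ⟨by rw [Matrix.det_nonsing_inv, hA.1, Ring.inverse_one], ?_⟩
  have h1 : A⁻¹ * A = 1 := Matrix.nonsing_inv_mul A hu
  calc A⁻¹ * e3 * A⁻¹ᴴ = A⁻¹ * (A * e3 * Aᴴ) * A⁻¹ᴴ := by rw [hA.2]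
    _ = (A⁻¹ * A) * e3 * (A⁻¹ * A)ᴴ := by
        simp only [Matrix.conjTranspose_mul, Matrix.mul_assoc]
    _ = e3 := by simp [h1]

lemma e3_mul_e3 : e3 * e3 = 1 := by
  ext i j
  fin_cases i <;> fin_cases j <;> simp [e3, Matrix.mul_apply]

lemma SU11.conjTranspose_mul_mul {A : Matrix (Fin 2) (Fin 2) ℂ} (hA : SU11 A) :
    Aᴴ * e3 * A = e3 := by
  have h : A * (e3 * Aᴴ * e3) = 1 := by
    rw [← e3_mul_e3]
    nth_rewrite 3 [← hA.2]
    simp only [Matrix.mul_assoc]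
  have h' : e3 * Aᴴ * e3 * A = 1 := mul_eq_one_comm.mp h
  calc Aᴴ * e3 * A = (e3 * e3) * (Aᴴ * e3 * A) := by rw [e3_mul_e3, one_mul]
    _ = e3 * (e3 * Aᴴ * e3 * A) := by simp only [Matrix.mul_assoc]
    _ = e3 := by rw [h', mul_one]

lemma SU11.normSq_sub {A : Matrix (Fin 2) (Fin 2) ℂ} (hA : SU11 A) (z : ℂ) :
    normSq (A 1 0 * z + A 1 1) - normSq (A 0 0 * z + A 0 1) = 1 - normSq z := by
  have h := hA.conjTranspose_mul_mul
  have h00 := congrFun (congrFun h 0) 0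
  have h01 := congrFun (congrFun h 0) 1
  have h10 := congrFun (congrFun h 1) 0
  have h11 := congrFun (congrFun h 1) 1
  simp [e3, Matrix.mul_apply, Fin.sum_univ_two] at h00 h01 h10 h11
  rw [← Complex.ofReal_inj]
  push_cast
  simp only [Complex.normSq_eq_conj_mul_self, map_add, map_mul]
  linear_combination -((starRingEnd ℂ) z * z) * h00 - ((starRingEnd ℂ) z) * h01 - z * h10 - h11

lemma SU11.denom_ne_zero {A : Matrix (Fin 2) (Fin 2) ℂ} (hA : SU11 A) {z : ℂ} (hz : ‖z‖ < 1) :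
    A 1 0 * z + A 1 1 ≠ 0 := by
  intro h0
  have h := hA.normSq_sub z
  have hz' : normSq z < 1 := by
    rw [Complex.normSq_eq_norm_sq]; nlinarith [norm_nonneg z]
  rw [h0, map_zero] at h
  linarith [normSq_nonneg (A 0 0 * z + A 0 1)]

lemma SU11.normSq_mobius_lt_one {A : Matrix (Fin 2) (Fin 2) ℂ} (hA : SU11 A) {z : ℂ}
    (hz : ‖z‖ < 1) : normSq (mobius A z) < 1 := by
  have h := hA.normSq_sub z
  have hz' : normSq z < 1 := by
    rw [Complex.normSq_eq_norm_sq]; nlinarith [norm_nonneg z]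
  rw [mobius, map_div₀, div_lt_one (normSq_pos.mpr (hA.denom_ne_zero hz))]
  linarith

lemma ne_one_of_normSq_lt_one {z : ℂ} (hz : normSq z < 1) : z ≠ 1 := by
  rintro rfl
  simp at hz

lemma im_mobius_Rmat_pos {z : ℂ} (hz : normSq z < 1) : 0 < (mobius Rmat z).im := by
  have h1 : 1 - z ≠ 0 := sub_ne_zero.mpr (ne_one_of_normSq_lt_one hz).symm
  have h2 : mobius Rmat z = I * ((1 + z) / (1 - z)) := by
    have h3 : z - 1 ≠ 0 := by rwa [← neg_ne_zero, neg_sub]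
    have h4 : mobius Rmat z = ((1 / 2) * (z + 1)) / ((1 / 2) * (I * (z - 1))) := by
      simp only [mobius, Rmat, Matrix.of_apply, Matrix.cons_val', Matrix.cons_val_zero,
        Matrix.cons_val_one]
      congr 1 <;> simp <;> ring
    rw [h4, mul_div_mul_left _ _ (by norm_num), div_eq_iff (mul_ne_zero I_ne_zero h3)]
    field_simp
    rw [I_sq]
    ring
  have h3 : (mobius Rmat z).im = (1 - normSq z) / normSq (1 - z) := by
    rw [h2, I_mul_im, div_re, ← add_div]
    congr 1
    simp [normSq_apply]
    ring
  rw [h3]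
  exact div_pos (by linarith) (normSq_pos.mpr h1)

lemma SU11.Rmat_mul_denom_ne_zero {A : Matrix (Fin 2) (Fin 2) ℂ} (hA : SU11 A) {z : ℂ}
    (hz : ‖z‖ < 1) : (Rmat * A) 1 0 * z + (Rmat * A) 1 1 ≠ 0 := by
  have h1 := ne_one_of_normSq_lt_one (hA.normSq_mobius_lt_one hz)
  intro h
  apply h1
  rw [mobius, div_eq_one_iff_eq (hA.denom_ne_zero hz)]
  simp [Rmat, Matrix.mul_apply, Fin.sum_univ_two] at h
  have h2 : (I / 2) * ((A 0 0 * z + A 0 1) - (A 1 0 * z + A 1 1)) = 0 := by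
    linear_combination h
  exact sub_eq_zero.mp ((mul_eq_zero.mp h2).resolve_left (by simp))

lemma SU11.im_mobius_Rmat_mul_pos {A : Matrix (Fin 2) (Fin 2) ℂ} (hA : SU11 A) {z : ℂ}
    (hz : ‖z‖ < 1) : 0 < (mobius (Rmat * A) z).im := by
  rw [mobius_mul _ _ (hA.denom_ne_zero hz)]
  exact im_mobius_Rmat_pos (hA.normSq_mobius_lt_one hz)

lemma Rmat_mul_Λp (t : ℝ) : Rmat * Λp t = !![1, 2 * (t : ℂ); 0, 1] * Rmat := by
  ext i j
  fin_cases i <;> fin_cases j <;> simp [Rmat, Λp, Matrix.mul_apply, Fin.sum_univ_two] <;>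
    ring

/-- The hyperbolic element of `SU(1,1)` corresponding to the dilation by `s ^ 2` of the upper
half-plane. -/
def dilation (s : ℝ) : Matrix (Fin 2) (Fin 2) ℂ :=
  !![((s + s⁻¹) / 2 : ℝ), ((s - s⁻¹) / 2 : ℝ); ((s - s⁻¹) / 2 : ℝ), ((s + s⁻¹) / 2 : ℝ)]

lemma SU11_dilation {s : ℝ} (hs : s ≠ 0) : SU11 (dilation s) := by
  have hs' : (s : ℂ) ≠ 0 := by exact_mod_cast hs
  constructor
  · simp [dilation, Matrix.det_fin_two]
    field_simp
    ring
  · ext i j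
    fin_cases i <;> fin_cases j <;>
      simp [dilation, e3, Matrix.mul_apply, Fin.sum_univ_two, Complex.conj_ofNat] <;>
      field_simp <;> ring

lemma Rmat_mul_dilation (s : ℝ) : Rmat * dilation s = !![(s : ℂ), 0; 0, (s : ℂ)⁻¹] * Rmat := by
  ext i j
  fin_cases i <;> fin_cases j <;> simp [Rmat, dilation, Matrix.mul_apply, Fin.sum_univ_two] <;>
    ring

/-- A holomorphic map from the left half-plane to the upper half-plane has moderate growth on
horizontal half-strips. -/
lemma exists_norm_le_of_im_pos {f : ℂ → ℂ} (hf : ∀ w : ℂ, w.re < 0 → DifferentiableAt ℂ f w)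
    (him : ∀ w : ℂ, w.re < 0 → 0 < (f w).im) :
    ∃ K : ℝ, ∀ w : ℂ, w.re ≤ -1 → |w.im| ≤ Real.pi → ‖f w‖ ≤ K * w.re ^ 2 := by
  have hmap (ζ : ℂ) (hζ : ζ ∈ ball (0 : ℂ) 1) : ζ - 1 ≠ 0 ∧ ((ζ + 1) / (ζ - 1)).re < 0 := by
    rw [mem_ball_zero_iff] at hζ
    have hne : ζ - 1 ≠ 0 := by
      intro h
      rw [sub_eq_zero.mp h] at hζ
      simp at hζ
    refine ⟨hne, ?_⟩
    have hlt : normSq ζ < 1 := by rw [normSq_eq_norm_sq]; nlinarith [norm_nonneg ζ]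
    have : ((ζ + 1) / (ζ - 1)).re = (normSq ζ - 1) / normSq (ζ - 1) := by
      rw [div_re, ← add_div]
      congr 1
      simp [normSq_apply]
      ring
    rw [this]
    exact div_neg_of_neg_of_pos (by linarith) (normSq_pos.mpr hne)
  have hd : DifferentiableOn ℂ (fun ζ => I * f ((ζ + 1) / (ζ - 1))) (ball 0 1) := by
    intro ζ hζ
    obtain ⟨hne, hre⟩ := hmap ζ hζ
    have h1 : DifferentiableAt ℂ (fun ζ : ℂ => (ζ + 1) / (ζ - 1)) ζ := by
      fun_prop (disch := exact hne)
    exact (((hf _ hre).comp ζ h1).const_mul I).differentiableWithinAt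
  have hM : Set.MapsTo (fun ζ => I * f ((ζ + 1) / (ζ - 1))) (ball 0 1)
      {z | z.re ≤ (1 : ℝ)} := by
    intro ζ hζ
    have := him _ (hmap ζ hζ).2
    simp only [Set.mem_ofPred_eq, I_mul_re]
    linarith
  set C : ℝ := ‖f (-1)‖ with hC
  refine ⟨20 * (1 + C), fun w hw hwi => ?_⟩
  have hw1 : w - 1 ≠ 0 := by
    intro h
    have := congrArg Complex.re h
    simp at this
    linarith
  set ζ : ℂ := (w + 1) / (w - 1) with hζdef
  have hns : 1 - ‖ζ‖ ^ 2 = -4 * w.re / normSq (w - 1) := by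
    rw [← normSq_eq_norm_sq, hζdef, map_div₀, eq_div_iff (normSq_pos.mpr hw1).ne',
      sub_mul, div_mul_cancel₀ _ (normSq_pos.mpr hw1).ne']
    simp [normSq_apply]
    ring
  have hpos := normSq_pos.mpr hw1
  have hζ2 : 0 < 1 - ‖ζ‖ ^ 2 := by
    rw [hns]
    exact div_pos (by linarith) hpos
  have hζ1 : ‖ζ‖ < 1 := by nlinarith [norm_nonneg ζ]
  have hinv : (ζ + 1) / (ζ - 1) = w := by
    have h1 : ζ - 1 = 2 / (w - 1) := by rw [hζdef]; field_simp; ring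
    have h2 : ζ + 1 = 2 * w / (w - 1) := by rw [hζdef]; field_simp; ring
    rw [h1, h2]
    field_simp
  have hB := borelCaratheodory one_pos hd hM one_pos (mem_ball_zero_iff.mpr hζ1)
  have h0 : ((0 : ℂ) + 1) / (0 - 1) = -1 := by norm_num
  simp only [hinv, h0, norm_mul, norm_I, one_mul, ← hC, mul_one, ← add_div] at hB
  refine hB.trans ?_
  rw [div_le_iff₀ (by linarith)]
  have hC0 : 0 ≤ C := norm_nonneg _
  have hn : normSq (w - 1) ≤ 20 * w.re ^ 2 := by
    have h4 : w.im ^ 2 ≤ 16 := by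
      have := Real.pi_lt_four
      rw [← sq_abs]
      nlinarith [abs_nonneg w.im]
    simp [normSq_apply]
    nlinarith
  have h5 : 4 ≤ 20 * w.re ^ 2 * (1 - ‖ζ‖ ^ 2) := by
    have h6 : normSq (w - 1) * (1 - ‖ζ‖ ^ 2) = -4 * w.re := by
      rw [hns]; field_simp
    have := mul_le_mul_of_nonneg_right hn hζ2.le
    linarith
  have h7 : 2 ≤ 20 * w.re ^ 2 * (1 - ‖ζ‖) := by
    have : 1 - ‖ζ‖ ^ 2 ≤ 2 * (1 - ‖ζ‖) := by nlinarith
    have := mul_le_mul_of_nonneg_left this (by positivity : 0 ≤ 20 * w.re ^ 2)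
    linarith
  calc 2 * ‖ζ‖ + C * (1 + ‖ζ‖) ≤ (1 + C) * 2 := by nlinarith [norm_nonneg ζ]
    _ ≤ (1 + C) * (20 * w.re ^ 2 * (1 - ‖ζ‖)) := by gcongr
    _ = _ := by ring

/-- A `2πi`-periodic holomorphic function on the left half-plane of moderate growth factors through
`exp` as a holomorphic function on the full unit disk. -/
lemma exists_eq_comp_exp {F : ℂ → ℂ} (hF : ∀ w : ℂ, w.re < 0 → DifferentiableAt ℂ F w)
    (hper : ∀ w : ℂ, w.re < 0 → F (w + 2 * Real.pi * I) = F w) {K : ℝ}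
    (hK : ∀ w : ℂ, w.re ≤ -1 → |w.im| ≤ Real.pi → ‖F w‖ ≤ K * w.re ^ 2) :
    ∃ h : ℂ → ℂ, DifferentiableOn ℂ h (ball (0 : ℂ) 1) ∧
      ∀ w : ℂ, w.re < 0 → F w = h (Complex.exp w) := by
  have hπ : (2 * Real.pi) ≠ 0 := by positivity
  have hπc : (Real.pi : ℂ) ≠ 0 := by exact_mod_cast Real.pi_ne_zero
  let G : ℂ → ℂ := fun z => if 0 < z.im then F (I * z) else 0
  have hG (z : ℂ) (hz : 0 < z.im) : G z = F (I * z) := if_pos hz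
  have hGper : Function.Periodic G (2 * Real.pi : ℝ) := by
    intro z
    by_cases hz : 0 < z.im
    · rw [hG z hz, hG _ (by simpa using hz), ← hper (I * z) (by simpa using hz)]
      congr 1
      push_cast
      ring
    · have : ¬ 0 < (z + (2 * Real.pi : ℝ)).im := by simpa using hz
      simp only [G, if_neg hz, if_neg this]
  have hq (z : ℂ) : Function.Periodic.qParam (2 * Real.pi) z = Complex.exp (I * z) := by
    rw [Function.Periodic.qParam]
    congr 1
    push_cast
    field_simp
  have hGd (z : ℂ) (hz : 0 < z.im) : DifferentiableAt ℂ G z := by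
    have h1 : DifferentiableAt ℂ (fun z => F (I * z)) z :=
      (hF (I * z) (by simpa using hz)).comp z (by fun_prop)
    refine h1.congr_of_eventuallyEq ?_
    filter_upwards [(isOpen_lt continuous_const Complex.continuous_im).mem_nhds hz] with y hy
    exact hG y hy
  set c := Function.Periodic.cuspFunction (2 * Real.pi) G with hc
  have hcexp (w : ℂ) (hw : w.re < 0) : c (Complex.exp w) = F w := by
    have h := Function.Periodic.eq_cuspFunction hπ hGper (-(I * w))
    rw [hq, hG _ (by simpa using hw)] at h
    have h2 : I * -(I * w) = w := by linear_combination (-w) * I_mul_I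
    rwa [h2] at h
  have hcd : DifferentiableOn ℂ c (ball 0 1 \ {0}) := by
    rintro q ⟨hq1, hq0⟩
    have hq0 : q ≠ 0 := hq0
    have hlog : (Complex.log q).re < 0 := by
      rw [log_re]
      exact Real.log_neg (norm_pos_iff.mpr hq0) (mem_ball_zero_iff.mp hq1)
    have h := Function.Periodic.differentiableAt_cuspFunction hπ hGper
      (hGd (-(I * Complex.log q)) (by simpa using hlog))
    rw [hq] at h
    have h2 : I * -(I * Complex.log q) = Complex.log q := by
      linear_combination (-Complex.log q) * I_mul_I
    rw [h2, exp_log hq0] at h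
    exact h.differentiableWithinAt
  have hnorm : Tendsto (fun q : ℂ => ‖q‖) (𝓝[≠] 0) (𝓝[>] 0) := tendsto_norm_nhdsNE_zero
  have hlogo : (fun q : ℂ => Real.log ‖q‖ ^ 2) =o[𝓝[≠] 0] fun q : ℂ => q⁻¹ := by
    have h1 := (isLittleO_abs_log_rpow_rpow_nhdsGT_zero 2 (s := -1) (by norm_num)).comp_tendsto
      hnorm
    refine IsLittleO.of_norm_right (h1.congr (fun q => ?_) (fun q => ?_))
    · simp
    · simp [Real.rpow_neg_one]
  have hone : (fun _ : ℂ => c 0) =o[𝓝[≠] 0] fun q : ℂ => q⁻¹ := by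
    refine isLittleO_const_left.mpr (Or.inr ?_)
    exact tendsto_norm_cobounded_atTop.comp tendsto_inv₀_nhdsNE_zero
  have hbig : c =O[𝓝[≠] 0] fun q : ℂ => Real.log ‖q‖ ^ 2 := by
    refine IsBigO.of_bound K ?_
    have hb : ball (0 : ℂ) (Real.exp (-1)) ∈ 𝓝[≠] (0 : ℂ) :=
      mem_nhdsWithin_of_mem_nhds (ball_mem_nhds _ (Real.exp_pos _))
    filter_upwards [hb, self_mem_nhdsWithin] with q hq1 hq0
    have hq0 : q ≠ 0 := hq0
    have hl : (Complex.log q).re ≤ -1 := by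
      rw [log_re, ← Real.log_exp (-1)]
      exact Real.log_le_log (norm_pos_iff.mpr hq0) (mem_ball_zero_iff.mp hq1).le
    have h := hK (Complex.log q) hl (by rw [log_im]; exact abs_arg_le_pi q)
    rw [← hcexp _ (by linarith), exp_log hq0, log_re] at h
    simpa using h
  refine ⟨Function.update c 0 (limUnder (𝓝[≠] 0) c),
    differentiableOn_update_limUnder_of_isLittleO (ball_mem_nhds _ one_pos) hcd ?_, ?_⟩
  · simpa using (hbig.trans_isLittleO hlogo).sub hone
  · intro w hw
    rw [Function.update_of_ne (exp_ne_zero w), hcexp w hw]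

/-- A holomorphic map from the left to the upper half-plane which is equivariant with respect to
`w ↦ w + 2πi` and a nontrivial real translation by `2t` is, up to a linear term, a holomorphic
function of `exp w` on the unit disk, and `t` is positive. -/
lemma exists_eq_comp_exp_sub {f : ℂ → ℂ} (hf : ∀ w : ℂ, w.re < 0 → DifferentiableAt ℂ f w)
    (him : ∀ w : ℂ, w.re < 0 → 0 < (f w).im) {t : ℝ} (ht : t ≠ 0)
    (heq : ∀ w : ℂ, w.re < 0 → f (w + 2 * Real.pi * I) = f w + 2 * t) :
    0 < t ∧ ∃ h : ℂ → ℂ, DifferentiableOn ℂ h (ball (0 : ℂ) 1) ∧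
      ∀ w : ℂ, w.re < 0 → f w = h (Complex.exp w) - (t / Real.pi : ℝ) * (I * w) := by
  have hπc : (Real.pi : ℂ) ≠ 0 := by exact_mod_cast Real.pi_ne_zero
  obtain ⟨K, hK⟩ := exists_norm_le_of_im_pos hf him
  have hlin (w : ℂ) (hw : w.re ≤ -1) (hwi : |w.im| ≤ Real.pi) :
      ‖((t / Real.pi : ℝ) : ℂ) * (I * w)‖ ≤ 5 * |t / Real.pi| * w.re ^ 2 := by
    have h1 : ‖w‖ ≤ 5 * w.re ^ 2 := by
      have := norm_le_abs_re_add_abs_im w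
      have h3 := Real.pi_lt_four
      rw [abs_of_neg (by linarith : w.re < 0)] at this
      nlinarith
    rw [norm_mul, norm_mul, norm_I, one_mul, norm_real, Real.norm_eq_abs]
    calc _ ≤ |t / Real.pi| * (5 * w.re ^ 2) := by gcongr
      _ = _ := by ring
  obtain ⟨h, hd, hh⟩ := exists_eq_comp_exp (F := fun w => f w + (t / Real.pi : ℝ) * (I * w))
    (K := K + 5 * |t / Real.pi|)
    (fun w hw => (hf w hw).add (by fun_prop))
    (fun w hw => by
      simp only [heq w hw]
      push_cast
      field_simp
      linear_combination (2 * (t : ℂ) * Real.pi) * I_sq)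
    (fun w hw hwi => by
      refine (norm_add_le _ _).trans ?_
      rw [add_mul]
      exact add_le_add (hK w hw hwi) (hlin w hw hwi))
  refine ⟨?_, h, hd, fun w hw => by rw [← hh w hw]; ring⟩
  by_contra hneg
  have ht' : t / Real.pi < 0 :=
    div_neg_of_neg_of_pos (lt_of_le_of_ne (not_lt.mp hneg) ht) Real.pi_pos
  have hexp : Tendsto (fun x : ℝ => Complex.exp (x : ℂ)) atBot (𝓝 0) := by
    simpa [Function.comp_def] using (continuous_ofReal.tendsto 0).comp Real.tendsto_exp_atBot
  have hlim : Tendsto (fun x : ℝ => (h (Complex.exp (x : ℂ))).im) atBot (𝓝 (h 0).im) :=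
    (continuous_im.tendsto _).comp
      (((hd.differentiableAt (ball_mem_nhds _ one_pos)).continuousAt.tendsto).comp hexp)
  have hinf : Tendsto (fun x : ℝ => (h (Complex.exp (x : ℂ))).im) atBot atTop := by
    refine tendsto_atTop_mono' _ ?_ (tendsto_id.const_mul_atBot_of_neg ht')
    filter_upwards [eventually_lt_atBot (0 : ℝ)] with x hx
    rw [← hh x (by simpa using hx)]
    have := him x (by simpa using hx)
    simp
    linarith
  exact not_tendsto_nhds_of_tendsto_atTop hinf _ hlim

/-- Normal form of a developing map with parabolic monodromy (first kind):
if `g` is holomorphic on the left half-plane with `|g| < 1` and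
`g(w + 2πi) = T ⋆ g(w)` with `T ∈ SU(1,1)` parabolic, then there are
`A ∈ SU(1,1)` and a function `h` holomorphic on the full unit disk such that
`((R·A) ⋆ g)(w) = h(e^w) − i·w`. -/
theorem parabolic_normal_form
    (g : ℂ → ℂ) (T : Matrix (Fin 2) (Fin 2) ℂ)
    (hg : ∀ w : ℂ, w.re < 0 → DifferentiableAt ℂ g w)
    (hg1 : ∀ w : ℂ, w.re < 0 → ‖g w‖ < 1)
    (hT : SU11 T)
    (hpar : ∃ (P : Matrix (Fin 2) (Fin 2) ℂ) (t : ℝ) (ε : ℂ),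
      SU11 P ∧ t ≠ 0 ∧ (ε = 1 ∨ ε = -1) ∧ P⁻¹ * T * P = ε • Λp t)
    (hmono : ∀ w : ℂ, w.re < 0 →
      g (w + 2 * Real.pi * Complex.I) = mobius T (g w)) :
    ∃ (A : Matrix (Fin 2) (Fin 2) ℂ) (h : ℂ → ℂ),
      SU11 A ∧
      DifferentiableOn ℂ h (ball (0 : ℂ) 1) ∧
      ∀ w : ℂ, w.re < 0 →
        mobius (Rmat * A) (g w) = h (Complex.exp w) - Complex.I * w := by
  obtain ⟨P, t, ε, hP, ht, hε, hPT⟩ := hpar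
  have hQ := hP.inv
  have hε0 : ε ≠ 0 := by rcases hε with rfl | rfl <;> norm_num
  have hPu : IsUnit P.det := by rw [hP.1]; exact isUnit_one
  have hconj : Rmat * P⁻¹ * T = ε • (!![1, 2 * (t : ℂ); 0, 1] * (Rmat * P⁻¹)) := by
    calc Rmat * P⁻¹ * T = Rmat * (P⁻¹ * T * P) * P⁻¹ := by
          simp only [Matrix.mul_assoc, Matrix.mul_nonsing_inv P hPu, mul_one]
      _ = _ := by
          rw [hPT, Matrix.mul_smul, Matrix.smul_mul, Rmat_mul_Λp, Matrix.mul_assoc]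
  have hden (w : ℂ) (hw : w.re < 0) := hQ.Rmat_mul_denom_ne_zero (hg1 w hw)
  have hfd (w : ℂ) (hw : w.re < 0) :
      DifferentiableAt ℂ (fun w => mobius (Rmat * P⁻¹) (g w)) w := by
    have := hg w hw
    have := hden w hw
    unfold mobius
    fun_prop (disch := assumption)
  obtain ⟨htpos, h, hd, hh⟩ := exists_eq_comp_exp_sub hfd
    (fun w hw => hQ.im_mobius_Rmat_mul_pos (hg1 w hw)) ht (fun w hw => by
      simp only [hmono w hw]
      rw [← mobius_mul _ _ (hT.denom_ne_zero (hg1 w hw)), hconj, mobius_smul hε0,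
        mobius_mul _ _ (hden w hw)]
      simp [mobius])
  set s : ℝ := Real.sqrt (Real.pi / t) with hs
  have hs2 : s * s = Real.pi / t := Real.mul_self_sqrt (by positivity)
  have hs0 : s ≠ 0 := (Real.sqrt_pos.mpr (by positivity)).ne'
  refine ⟨dilation s * P⁻¹, fun z => (Real.pi / t : ℝ) * h z, (SU11_dilation hs0).mul hQ,
    hd.const_mul _, fun w hw => ?_⟩
  rw [← Matrix.mul_assoc, Rmat_mul_dilation, Matrix.mul_assoc, mobius_mul _ _ (hden w hw)]
  have hmob (z : ℂ) : mobius !![(s : ℂ), 0; 0, (s : ℂ)⁻¹] z = (Real.pi / t : ℝ) * z := by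
    rw [← hs2]
    simp [mobius]
    ring
  have htc : (t : ℂ) ≠ 0 := by exact_mod_cast ht
  have hπc : (Real.pi : ℂ) ≠ 0 := by exact_mod_cast Real.pi_ne_zero
  rw [hmob, hh w hw]
  push_cast
  field_simp
end
end
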